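/- The Gray configuration has an isometric point-circle realization in the plane: there exist a bipartition class choice ε ∈ {0,1} and injective maps p : {v : ZMod 54 // v.val % 2 = ε} → ℝ² (points) and c : {w : ZMod 54 // w.val % 2 ≠ ε} → ℝ² (centers of unit circles), with the images of p and c disjoint, such that for every point vertex v and every circle vertex w, v and w are adjacent in the Gray graph if and only if the Euclidean distance between p(v) and c(w) equals 1 (i.e. p(v) lies on the unit circle centered at c(w)). -/

import Mathlib

def lcfD (x : ZMod 6) : ℤ :=
  if x = 0 then 7 else if x = 1 then -7 else if x = 2 then 13
  else if x = 3 then -13 else if x = 4 then 25 else -25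

def grayGraph : SimpleGraph (ZMod 54) :=
  SimpleGraph.fromRel (fun u v => v = u + 1 ∨ v = u + ((lcfD ((u.val : ZMod 6))) : ZMod 54))

/-- Nine integer vectors of length `65`, in three groups of three. -/
def lengthVector (i : Fin 9) : ℤ × ℤ :=
  ![(25, 60), (-52, 39), (-33, -56), (39, 52), (65, 0), (-63, 16), (-60, -25), (0, 65), (33, -56)] i

/-- The Gray graph is the incidence graph between the points and the axis-parallel lines of the
`3 × 3 × 3` grid. A point is recorded by its three coordinates, a line by the two coordinates that
are constant along it; the coordinates along the three axes are numbered `0, 1, 2`, then `3, 4, 5`,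
then `6, 7, 8`. -/
def grayLabel (v : ZMod 54) : List (Fin 9) :=
  ![[0, 3], [0, 3, 6], [0, 6], [0, 4, 6], [0, 4], [0, 4, 7],
    [0, 7], [0, 3, 7], [3, 7], [2, 3, 7], [2, 7], [2, 5, 7],
    [5, 7], [0, 5, 7], [0, 5], [0, 5, 6], [5, 6], [1, 5, 6],
    [1, 5], [1, 5, 7], [1, 7], [1, 3, 7], [1, 3], [1, 3, 8],
    [1, 8], [1, 5, 8], [5, 8], [0, 5, 8], [0, 8], [0, 4, 8],
    [4, 8], [1, 4, 8], [1, 4], [1, 4, 7], [4, 7], [2, 4, 7],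
    [2, 4], [2, 4, 8], [2, 8], [2, 5, 8], [2, 5], [2, 5, 6],
    [2, 6], [2, 4, 6], [4, 6], [1, 4, 6], [1, 6], [1, 3, 6],
    [3, 6], [2, 3, 6], [2, 3], [2, 3, 8], [3, 8], [0, 3, 8]] v

/-- The sum of the vectors attached to the grid coordinates of a vertex: a grid point then lies at
distance `65` from each of the three grid lines through it. -/
def grayPosition (v : ZMod 54) : ℤ × ℤ :=
  ((grayLabel v).map lengthVector).sum

lemma grayPosition_injective : Function.Injective grayPosition := by
  have h : ∀ v w : ZMod 54, grayPosition v = grayPosition w → v = w := by decide +kernel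
  exact fun v w => h v w

instance : DecidableRel grayGraph.Adj := fun u v =>
  decidable_of_iff _ (SimpleGraph.fromRel_adj _ u v).symm

lemma grayGraph_adj_iff (v w : ZMod 54) (hv : v.val % 2 = 1) (hw : w.val % 2 ≠ 1) :
    grayGraph.Adj v w ↔
      ((grayPosition v).1 - (grayPosition w).1) ^ 2 +
        ((grayPosition v).2 - (grayPosition w).2) ^ 2 = 65 ^ 2 := by
  have h : ∀ v w : ZMod 54, v.val % 2 = 1 → w.val % 2 ≠ 1 →
      (grayGraph.Adj v w ↔
        ((grayPosition v).1 - (grayPosition w).1) ^ 2 +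
          ((grayPosition v).2 - (grayPosition w).2) ^ 2 = 65 ^ 2) := by decide +kernel
  exact h v w hv hw

/-- The point of the plane with coordinates `a.1 / 65` and `a.2 / 65`. -/
noncomputable def scaledPoint (a : ℤ × ℤ) : EuclideanSpace ℝ (Fin 2) :=
  !₂[(a.1 : ℝ) / 65, (a.2 : ℝ) / 65]

lemma scaledPoint_injective : Function.Injective scaledPoint := by
  intro a b h
  have h0 := congrArg (fun x : EuclideanSpace ℝ (Fin 2) => x 0) h
  have h1 := congrArg (fun x : EuclideanSpace ℝ (Fin 2) => x 1) h
  simp [scaledPoint] at h0 h1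
  exact Prod.ext h0 h1

lemma dist_scaledPoint_eq_one_iff (a b : ℤ × ℤ) :
    dist (scaledPoint a) (scaledPoint b) = 1 ↔
      (a.1 - b.1) ^ 2 + (a.2 - b.2) ^ 2 = 65 ^ 2 := by
  rw [EuclideanSpace.dist_eq, Real.sqrt_eq_one, Fin.sum_univ_two, Real.dist_eq, Real.dist_eq,
    sq_abs, sq_abs, ← @Int.cast_inj ℝ]
  simp only [scaledPoint, Matrix.cons_val_zero, Matrix.cons_val_one]
  push_cast
  constructor <;> intro h <;> linarith

/-- The Gray configuration has an isometric point-circle realization in the plane: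
the vertices of one parity class of the Gray graph are realized as points, those of the
other class as centers of unit circles, and incidence corresponds exactly to adjacency. -/
theorem gray_configuration_isometric_point_circle :
    ∃ (ε : ℕ), ε < 2 ∧
      ∃ (p : {v : ZMod 54 // v.val % 2 = ε} → EuclideanSpace ℝ (Fin 2))
        (c : {w : ZMod 54 // w.val % 2 ≠ ε} → EuclideanSpace ℝ (Fin 2)),
        Function.Injective p ∧ Function.Injective c ∧
        (∀ v w, p v ≠ c w) ∧
        (∀ (v : {v : ZMod 54 // v.val % 2 = ε}) (w : {w : ZMod 54 // w.val % 2 ≠ ε}),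
          grayGraph.Adj (v : ZMod 54) (w : ZMod 54) ↔ dist (p v) (c w) = 1) := by
  have h_inj := scaledPoint_injective.comp grayPosition_injective
  refine ⟨1, by norm_num, fun v => scaledPoint (grayPosition v),
    fun w => scaledPoint (grayPosition w), h_inj.comp Subtype.val_injective,
    h_inj.comp Subtype.val_injective, fun v w h => ?_, fun v w => ?_⟩
  · exact w.2 (h_inj h ▸ v.2)
  · rw [dist_scaledPoint_eq_one_iff]
    exact grayGraph_adj_iff v w v.2 w.2
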